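/- (Parity of the resolvent symbols of an odd class operator.) With the data and recursion described in the context, for every j ≥ 0 and every (x, ξ, λ) ∈ Ω one has (x, −ξ, (−1)^m λ) ∈ Ω and q_{−m−j}(x, −ξ, (−1)^m λ) = (−1)^{m+j} q_{−m−j}(x, ξ, λ). -/

import Mathlib

open Complex

noncomputable section

attribute [local instance] Matrix.linftyOpNormedRing Matrix.linftyOpNormedAlgebra

variable {n d : ℕ}

/-- First-order partial derivative `∂/∂x_i` of a function on `ℝⁿ` with values in a normed
space. -/
def pderiv1 {M : Type*} [NormedAddCommGroup M] [NormedSpace ℝ M] (i : Fin n)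
    (f : (Fin n → ℝ) → M) : (Fin n → ℝ) → M :=
  fun x => fderiv ℝ f x (Pi.single i 1)

/-- Iterated partial derivatives along a list of coordinate directions. -/
def derivAlong {M : Type*} [NormedAddCommGroup M] [NormedSpace ℝ M] :
    List (Fin n) → ((Fin n → ℝ) → M) → (Fin n → ℝ) → M
  | [], f => f
  | i :: l, f => pderiv1 i (derivAlong l f)

/-- The list of coordinate directions encoded by a multi-index `α ∈ ℕⁿ`
(direction `i` repeated `α i` times). -/
def multiIndexList (α : Fin n → ℕ) : List (Fin n) :=
  (List.finRange n).flatMap fun i => List.replicate (α i) i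

/-- The iterated partial derivative `∂^α = ∂_1^{α 1} ⋯ ∂_n^{α n}` attached to the
multi-index `α`. -/
def mderiv {M : Type*} [NormedAddCommGroup M] [NormedSpace ℝ M] (α : Fin n → ℕ)
    (f : (Fin n → ℝ) → M) : (Fin n → ℝ) → M :=
  derivAlong (multiIndexList α) f

/-- The length `|α| = α 1 + ⋯ + α n` of a multi-index. -/
def msize (α : Fin n → ℕ) : ℕ := ∑ i, α i

/-- The factorial `α! = (α 1)! ⋯ (α n)!` of a multi-index. -/
def mfact (α : Fin n → ℕ) : ℕ := ∏ i, (α i).factorial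

open Filter Topology in
/-- Iterated partial derivatives are local and commute with multiplication by a constant. -/
lemma derivAlong_eventuallyEq_const_smul {M : Type*} [NormedAddCommGroup M] [NormedSpace ℝ M]
    {𝕜 : Type*} [NormedField 𝕜] [NormedSpace 𝕜 M] [SMulCommClass ℝ 𝕜 M]
    (c : 𝕜) {f g : (Fin n → ℝ) → M} {x : Fin n → ℝ} (h : f =ᶠ[𝓝 x] c • g) (L : List (Fin n)) :
    derivAlong L f =ᶠ[𝓝 x] c • derivAlong L g := by
  induction L with
  | nil => exact h
  | cons i L ih =>
    refine (ih.fderiv (𝕜 := ℝ)).mono fun y hy => ?_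
    simp only [derivAlong, pderiv1, hy, fderiv_const_smul_field, Pi.smul_apply,
      smul_apply]

open Filter Topology in
lemma mderiv_eq_const_smul {M : Type*} [NormedAddCommGroup M] [NormedSpace ℝ M]
    {𝕜 : Type*} [NormedField 𝕜] [NormedSpace 𝕜 M] [SMulCommClass ℝ 𝕜 M]
    (c : 𝕜) {f g : (Fin n → ℝ) → M} {x : Fin n → ℝ} (h : f =ᶠ[𝓝 x] c • g) (α : Fin n → ℕ) :
    mderiv α f x = c • mderiv α g x :=
  (derivAlong_eventuallyEq_const_smul c h _).eq_of_nhds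

lemma pderiv1_comp_neg {M : Type*} [NormedAddCommGroup M] [NormedSpace ℝ M] (i : Fin n)
    (f : (Fin n → ℝ) → M) (x : Fin n → ℝ) :
    pderiv1 i (fun y => f (-y)) x = -pderiv1 i f (-x) := by
  have h := ContinuousLinearEquiv.comp_right_fderiv
    (ContinuousLinearEquiv.neg ℝ : (Fin n → ℝ) ≃L[ℝ] (Fin n → ℝ)) (f := f) (x := x)
  have h' := congrArg (fun T => T (Pi.single i 1)) h
  simpa [pderiv1, Function.comp_def] using h'

lemma derivAlong_comp_neg {M : Type*} [NormedAddCommGroup M] [NormedSpace ℝ M]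
    (f : (Fin n → ℝ) → M) (L : List (Fin n)) :
    derivAlong L (fun y => f (-y)) = fun x => (-1 : ℝ) ^ L.length • derivAlong L f (-x) := by
  induction L with
  | nil => simp [derivAlong]
  | cons i L ih =>
    funext x
    have h : pderiv1 i (fun y => (-1 : ℝ) ^ L.length • derivAlong L f (-y)) x
        = (-1 : ℝ) ^ L.length • pderiv1 i (fun y => derivAlong L f (-y)) x := by
      change fderiv ℝ ((-1 : ℝ) ^ L.length • fun y => derivAlong L f (-y)) x _ = _
      rw [fderiv_const_smul_field]
      rfl
    simp only [derivAlong, ih, List.length_cons]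
    rw [h, pderiv1_comp_neg, pow_succ, mul_neg_one, neg_smul, smul_neg]

lemma length_multiIndexList (α : Fin n → ℕ) : (multiIndexList α).length = msize α := by
  simp [multiIndexList, msize, List.length_flatMap, Fin.sum_univ_def]

lemma mderiv_comp_neg {M : Type*} [NormedAddCommGroup M] [NormedSpace ℝ M] (α : Fin n → ℕ)
    (f : (Fin n → ℝ) → M) (x : Fin n → ℝ) :
    mderiv α (fun y => f (-y)) x = (-1 : ℝ) ^ msize α • mderiv α f (-x) := by
  rw [mderiv, derivAlong_comp_neg, length_multiIndexList, mderiv]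

open Filter Topology in
/-- The derivative `∂^α` of a function of parity `c` has parity `(-1)^|α| c`. -/
lemma mderiv_neg_of_parity {M : Type*} [NormedAddCommGroup M] [NormedSpace ℂ M]
    (c : ℂ) {f : (Fin n → ℝ) → M} {x : Fin n → ℝ}
    (h : ∀ᶠ y in 𝓝 x, f (-y) = c • f y) (α : Fin n → ℕ) :
    mderiv α f (-x) = ((-1 : ℂ) ^ msize α * c) • mderiv α f x := by
  have h₁ := mderiv_eq_const_smul c (f := fun y => f (-y)) (g := f) h α
  rw [mderiv_comp_neg] at h₁
  rw [mul_smul, ← h₁]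
  rcases Nat.even_or_odd (msize α) with h₂ | h₂ <;> simp [h₂.neg_one_pow]

lemma ringInverse_neg_one_pow_smul {A : Type*} [Ring A] [Algebra ℂ A] (m : ℕ) {a : A}
    (ha : IsUnit a) :
    Ring.inverse ((-1 : ℂ) ^ m • a) = (-1 : ℂ) ^ m • Ring.inverse a := by
  obtain ⟨u, rfl⟩ := ha
  rcases neg_one_pow_eq_or ℂ m with h | h <;> rw [h]
  · simp
  · rw [neg_one_smul, neg_one_smul, ← Units.val_neg, Ring.inverse_unit, Ring.inverse_unit,
      inv_neg, Units.val_neg]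

lemma neg_one_zpow_sub_eq (m j : ℕ) : (-1 : ℂ) ^ ((m : ℤ) - (j : ℤ)) = (-1 : ℂ) ^ (m + j) := by
  rw [zpow_sub₀ (by norm_num), zpow_natCast, zpow_natCast, pow_add, div_eq_mul_inv, ← inv_pow,
    inv_neg_one]

/-- **parity of the resolvent symbols of an odd class operator.**
Let `U ⊆ ℝⁿ` be open, `m ≥ 1` an integer, and for each `j ≥ 0` let
`p j : U × (ℝⁿ ∖ {0}) → M_d(ℂ)` (standing for `p_{m-j}`) be smooth and satisfy the odd class
parity `p_{m-j}(x, -ξ) = (-1)^{m-j} p_{m-j}(x, ξ)`. Let `Ω` be the open set of `(x, ξ, λ)`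
with `x ∈ U`, `ξ ≠ 0` and `p_m(x,ξ) - λ` invertible, and on `Ω` let
`q j` (standing for `q_{-m-j}`) be the smooth symbols defined by the resolvent recursion
`q_{-m}= (p_m - λ)⁻¹` and, for `j ≥ 1`,
`q_{-m-j} = -(p_m - λ)⁻¹ Σ_{|α|+k+l=j, l≠j} (1/α!) ∂_ξ^α p_{m-k} · D_x^α q_{-m-l}`
(with `D_x^α = (-i)^{|α|} ∂_x^α`). Then for every `j ≥ 0` and `(x, ξ, λ) ∈ Ω` one has
`(x, -ξ, (-1)^m λ) ∈ Ω` and `q_{-m-j}(x, -ξ, (-1)^m λ) = (-1)^{m+j} q_{-m-j}(x, ξ, λ)`. -/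
theorem resolvent_symbols_parity
    (hn : 1 ≤ n) (hd : 1 ≤ d) (m : ℕ) (hm : 1 ≤ m)
    (U : Set (Fin n → ℝ)) (hU : IsOpen U)
    (p : ℕ → (Fin n → ℝ) → (Fin n → ℝ) → Matrix (Fin d) (Fin d) ℂ)
    (hpsmooth : ∀ j, ContDiffOn ℝ (⊤ : ℕ∞) (fun w : (Fin n → ℝ) × (Fin n → ℝ) => p j w.1 w.2)
      (U ×ˢ {ξ : Fin n → ℝ | ξ ≠ 0}))
    (hppar : ∀ j, ∀ x ∈ U, ∀ ξ : Fin n → ℝ, ξ ≠ 0 →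
      p j x (-ξ) = ((-1 : ℂ) ^ ((m : ℤ) - (j : ℤ))) • p j x ξ)
    (Ω : Set ((Fin n → ℝ) × (Fin n → ℝ) × ℂ))
    (hΩ : Ω = {w : (Fin n → ℝ) × (Fin n → ℝ) × ℂ |
      w.1 ∈ U ∧ w.2.1 ≠ 0 ∧ IsUnit (p 0 w.1 w.2.1 - w.2.2 • 1)})
    (q : ℕ → (Fin n → ℝ) → (Fin n → ℝ) → ℂ → Matrix (Fin d) (Fin d) ℂ)
    (hqsmooth : ∀ j, ContDiffOn ℝ (⊤ : ℕ∞)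
      (fun w : (Fin n → ℝ) × (Fin n → ℝ) × ℂ => q j w.1 w.2.1 w.2.2) Ω)
    (hq0 : ∀ x ξ lam, (x, ξ, lam) ∈ Ω →
      q 0 x ξ lam = Ring.inverse (p 0 x ξ - lam • 1))
    (hqrec : ∀ j, 1 ≤ j → ∀ x ξ lam, (x, ξ, lam) ∈ Ω →
      q j x ξ lam = -Ring.inverse (p 0 x ξ - lam • 1) *
        ∑ α ∈ Fintype.piFinset (fun _ : Fin n => Finset.range (j + 1)),
          ∑ k ∈ Finset.range (j + 1), ∑ l ∈ Finset.range (j + 1),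
            if msize α + k + l = j ∧ l ≠ j then
              ((mfact α : ℂ))⁻¹ •
                (mderiv α (p k x) ξ *
                  ((-Complex.I) ^ msize α • mderiv α (fun y => q l y ξ lam) x))
            else 0) :
    ∀ j, ∀ x ξ lam, (x, ξ, lam) ∈ Ω →
      (x, -ξ, ((-1 : ℂ) ^ m * lam)) ∈ Ω ∧
      q j x (-ξ) ((-1 : ℂ) ^ m * lam) = ((-1 : ℂ) ^ (m + j)) • q j x ξ lam := by
  simp only [neg_one_zpow_sub_eq] at hppar
  have hmem : ∀ x ξ lam, (x, ξ, lam) ∈ Ω ↔ x ∈ U ∧ ξ ≠ 0 ∧ IsUnit (p 0 x ξ - lam • 1) := by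
    intro x ξ lam
    rw [hΩ]
    rfl
  have hsym : ∀ x ∈ U, ∀ ξ : Fin n → ℝ, ξ ≠ 0 → ∀ lam : ℂ,
      p 0 x (-ξ) - ((-1 : ℂ) ^ m * lam) • 1 = (-1 : ℂ) ^ m • (p 0 x ξ - lam • 1) := by
    intro x hx ξ hξ lam
    rw [hppar 0 x hx ξ hξ, add_zero, smul_sub, mul_smul]
  have hneg : ∀ x ξ lam, (x, ξ, lam) ∈ Ω → (x, -ξ, ((-1 : ℂ) ^ m * lam)) ∈ Ω := by
    intro x ξ lam h
    obtain ⟨hx, hξ, hu⟩ := (hmem _ _ _).1 h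
    refine (hmem _ _ _).2 ⟨hx, neg_ne_zero.2 hξ, ?_⟩
    rw [hsym x hx ξ hξ]
    rcases neg_one_pow_eq_or ℂ m with h | h <;> rw [h]
    · simpa using hu
    · simpa only [neg_one_smul] using hu.neg
  have hnear : ∀ x ξ lam, (x, ξ, lam) ∈ Ω → ∀ᶠ y in nhds x, (y, ξ, lam) ∈ Ω := by
    intro x ξ lam h
    obtain ⟨hx, hξ, hu⟩ := (hmem _ _ _).1 h
    have : CompleteSpace (Matrix (Fin d) (Fin d) ℂ) := FiniteDimensional.complete ℂ _
    have hopen : IsOpen (U ×ˢ {ξ : Fin n → ℝ | ξ ≠ 0}) := hU.prod isOpen_ne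
    have hc : ContinuousAt (fun w : (Fin n → ℝ) × (Fin n → ℝ) => p 0 w.1 w.2) (x, ξ) :=
      (hpsmooth 0).continuousOn.continuousAt (hopen.mem_nhds ⟨hx, hξ⟩)
    have hc₁ : ContinuousAt (fun y => p 0 y ξ) x :=
      hc.comp (f := fun y : Fin n → ℝ => (y, ξ)) (by fun_prop)
    have hc₂ : ContinuousAt (fun y => p 0 y ξ - lam • 1) x := hc₁.sub continuousAt_const
    filter_upwards [hU.mem_nhds hx, hc₂.eventually (Units.isOpen.mem_nhds hu)] with y hy hy'
    exact (hmem _ _ _).2 ⟨hy, hξ, hy'⟩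
  intro j
  induction j using Nat.strong_induction_on with
  | _ j ih =>
  intro x ξ lam h
  have h' := hneg x ξ lam h
  refine ⟨h', ?_⟩
  obtain ⟨hx, hξ, hu⟩ := (hmem _ _ _).1 h
  rcases Nat.eq_zero_or_pos j with rfl | hj
  · rw [hq0 _ _ _ h', hq0 _ _ _ h, hsym x hx ξ hξ, ringInverse_neg_one_pow_smul m hu, add_zero]
  rw [hqrec j hj _ _ _ h', hqrec j hj _ _ _ h, hsym x hx ξ hξ, ringInverse_neg_one_pow_smul m hu,
    pow_add, mul_smul, ← smul_neg, smul_mul_assoc,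
    ← mul_smul_comm ((-1 : ℂ) ^ j)]
  congr 2
  simp only [Finset.smul_sum]
  refine Finset.sum_congr rfl fun α _ => Finset.sum_congr rfl fun k _ =>
    Finset.sum_congr rfl fun l _ => ?_
  split_ifs with hl
  · have hp : mderiv α (p k x) (-ξ)
        = ((-1 : ℂ) ^ msize α * (-1) ^ (m + k)) • mderiv α (p k x) ξ := by
      refine mderiv_neg_of_parity _ ?_ α
      filter_upwards [isOpen_ne.mem_nhds hξ] with η hη
      exact hppar k x hx η hη
    have hq : mderiv α (fun y => q l y (-ξ) ((-1 : ℂ) ^ m * lam)) x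
        = (-1 : ℂ) ^ (m + l) • mderiv α (fun y => q l y ξ lam) x := by
      refine mderiv_eq_const_smul _ ?_ α
      filter_upwards [hnear x ξ lam h] with y hy
      exact (ih l (by omega) y ξ lam hy).2
    have hsign : (-1 : ℂ) ^ msize α * (-1) ^ (m + k) * (-1) ^ (m + l) = (-1) ^ j := by
      rw [← hl.1, ← pow_add, ← pow_add,
        show msize α + (m + k) + (m + l) = 2 * m + (msize α + k + l) by ring, pow_add, pow_mul]
      simp
    rw [hp, hq, ← hsign]
    simp only [smul_mul_assoc, mul_smul_comm, smul_smul]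
    congr 1
    ring
  · rw [smul_zero]

end
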